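/- The stabilizer in ∏_{i=1}^p GL(α_i,k) × ∏_{j=1}^q GL(β_j,k) of the standard bi-hinge determined by dimension data (α_i^j) consists exactly of the pairs (g,h) such that: (1) each g_i is block lower triangular with respect to the decomposition V_i = ⊕_{j=1}^q V_i^j (i.e., g_i ∈ P_-(α_i^1,...,α_i^q)); (2) each h_j is block upper triangular with respect to the decomposition W_j = ⊕_{i=1}^p W_j^i (i.e., h_j ∈ P_+(α_1^j,...,α_p^j)); and (3) for all i, j, the j-th diagonal block of g_i (an α_i^j × α_i^j matrix) equals the i-th diagonal block of h_j under the coordinate identification V_i^j ≅ W_j^i. Consequently the stabilizer is the semidirect product of the reductive group ∏_{i,j} GL(α_i^j,k) (embedded diagonally via the matching diagonal blocks) and the unipotent group ∏_{i=1}^p T_-(α_i^1,...,α_i^q) × ∏_{j=1}^q T_+(α_1^j,...,α_p^j). (Lemma 2.3(b).) -/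

import Mathlib

namespace Neretin

open scoped BigOperators

variable {k : Type*} [Field k]

/-- Offset of the `i`-th block of the partition `α`. -/
def off {p : ℕ} (α : Fin p → ℕ) (i : Fin p) : ℕ := ∑ i' ∈ Finset.Iio i, α i'

theorem coord_lt {p n : ℕ} {α : Fin p → ℕ} (hα : ∑ i, α i = n) (i : Fin p)
    (t : Fin (α i)) : off α i + (t : ℕ) < n := by
  have h1 : off α i + α i ≤ n := by
    rw [← hα]
    have h2 : insert i (Finset.Iio i) = Finset.Iic i := Finset.Iio_insert i
    have h3 : off α i + α i = ∑ i' ∈ Finset.Iic i, α i' := by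
      rw [← h2, Finset.sum_insert (by simp)]
      unfold off
      omega
    rw [h3]
    exact Finset.sum_le_sum_of_subset (Finset.subset_univ _)
  have h4 := t.isLt
  omega

/-- The coordinate of `k^n` corresponding to the `t`-th coordinate of the `i`-th block. -/
def coord {p n : ℕ} {α : Fin p → ℕ} (hα : ∑ i, α i = n) (i : Fin p) (t : Fin (α i)) : Fin n :=
  ⟨off α i + (t : ℕ), coord_lt hα i t⟩

/-- Subspace of vectors vanishing at all coordinates satisfying `P`. -/
def vanishOn {ι : Type*} (P : ι → Prop) : Submodule k (ι → k) :=
  ⨅ r ∈ {r : ι | P r}, LinearMap.ker (LinearMap.proj (R := k) (φ := fun _ : ι => k) r)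

/-- The linear relation `χ_ij(A) : V_i ⇉ W_j`. -/
def chi {p q n : ℕ} (α : Fin p → ℕ) (β : Fin q → ℕ) (hα : ∑ i, α i = n) (hβ : ∑ j, β j = n)
    (A : Matrix (Fin n) (Fin n) k) (i : Fin p) (j : Fin q) :
    Submodule k ((Fin (α i) → k) × (Fin (β j) → k)) :=
  Submodule.map
    ((LinearMap.funLeft k k (coord hα i)).prod
      ((LinearMap.funLeft k k (coord hβ j)).comp (Matrix.mulVecLin A)))
    (vanishOn (fun r : Fin n => off α i + α i ≤ (r : ℕ)) ⊓
      Submodule.comap (Matrix.mulVecLin A) (vanishOn fun r : Fin n => (r : ℕ) < off β j))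

section Rel

variable {X Y : Type*} [AddCommGroup X] [Module k X] [AddCommGroup Y] [Module k Y]

/-- Kernel of a linear relation. -/
def rker (L : Submodule k (X × Y)) : Submodule k X := Submodule.comap (LinearMap.inl k X Y) L

/-- Domain of a linear relation. -/
def rdom (L : Submodule k (X × Y)) : Submodule k X := Submodule.map (LinearMap.fst k X Y) L

/-- Image of a linear relation. -/
def rim (L : Submodule k (X × Y)) : Submodule k Y := Submodule.map (LinearMap.snd k X Y) L

/-- Indefiniteness of a linear relation. -/
def rindef (L : Submodule k (X × Y)) : Submodule k Y := Submodule.comap (LinearMap.inr k X Y) L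

end Rel

/-- `blockLT α a b`: coordinate `a` lies in a strictly earlier block than `b`. -/
def blockLT {p : ℕ} (α : Fin p → ℕ) (a b : ℕ) : Prop :=
  ∃ i : Fin p, off α i ≤ b ∧ a < off α i

/-- `sameBlock α a b` : coordinates `a`, `b` lie in the same block. -/
def sameBlock {p : ℕ} (α : Fin p → ℕ) (a b : ℕ) : Prop :=
  ∀ i : Fin p, off α i ≤ a ↔ off α i ≤ b

/-- Block upper triangular matrices (the group `P_+`). -/
def IsPPlus {n p : ℕ} (α : Fin p → ℕ) (g : Matrix (Fin n) (Fin n) k) : Prop :=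
  ∀ r s : Fin n, blockLT α (s : ℕ) (r : ℕ) → g r s = 0

/-- Block lower triangular matrices (the group `P_-`). -/
def IsPMinus {n p : ℕ} (α : Fin p → ℕ) (g : Matrix (Fin n) (Fin n) k) : Prop :=
  ∀ r s : Fin n, blockLT α (r : ℕ) (s : ℕ) → g r s = 0

/-- Block strictly upper triangular matrices (the group `T_+`). -/
def IsTPlus {n p : ℕ} (α : Fin p → ℕ) (g : Matrix (Fin n) (Fin n) k) : Prop :=
  IsPPlus α g ∧ ∀ r s : Fin n, sameBlock α (r : ℕ) (s : ℕ) → g r s = if r = s then 1 else 0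

/-- Block strictly lower triangular matrices (the group `T_-`). -/
def IsTMinus {n p : ℕ} (α : Fin p → ℕ) (g : Matrix (Fin n) (Fin n) k) : Prop :=
  IsPMinus α g ∧ ∀ r s : Fin n, sameBlock α (r : ℕ) (s : ℕ) → g r s = if r = s then 1 else 0

/-- Bi-hinges. -/
def IsBiHinge {p q : ℕ} (α : Fin p → ℕ) (β : Fin q → ℕ)
    (ξ : (i : Fin p) → (j : Fin q) → Submodule k ((Fin (α i) → k) × (Fin (β j) → k))) : Prop :=
  (∀ (i : Fin p) (j j' : Fin q), (j' : ℕ) = (j : ℕ) + 1 → rker (ξ i j) = rdom (ξ i j')) ∧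
  (∀ (i i' : Fin p) (j : Fin q), (i' : ℕ) = (i : ℕ) + 1 → rim (ξ i j) = rindef (ξ i' j)) ∧
  (∀ (i : Fin p) (j : Fin q), (i : ℕ) = 0 → rindef (ξ i j) = ⊥) ∧
  (∀ (i : Fin p) (j : Fin q), (i : ℕ) + 1 = p → rim (ξ i j) = ⊤) ∧
  (∀ (i : Fin p) (j : Fin q), (j : ℕ) + 1 = q → rker (ξ i j) = ⊥) ∧
  (∀ (i : Fin p) (j : Fin q), (j : ℕ) = 0 → rdom (ξ i j) = ⊤)

/-- 0-1 matrices with exactly one unit in each row and each column. -/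
def IsPermMatrix {n : ℕ} (M : Matrix (Fin n) (Fin n) k) : Prop :=
  ∃ σ : Equiv.Perm (Fin n), ∀ r s, M r s = if r = σ s then 1 else 0

/-- Offset of the sub-block `V_i^j` inside `V_i`. -/
def offA {p q : ℕ} (a : Fin p → Fin q → ℕ) (i : Fin p) (j : Fin q) : ℕ :=
  ∑ j' ∈ Finset.Iio j, a i j'

/-- Offset of the sub-block `W_j^i` inside `W_j`. -/
def offB {p q : ℕ} (a : Fin p → Fin q → ℕ) (i : Fin p) (j : Fin q) : ℕ :=
  ∑ i' ∈ Finset.Iio i, a i' j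

open Classical in
/-- The standard 0-1 matrix determined by the dimension data `a`. -/
noncomputable def stdMatrix {p q : ℕ} (n : ℕ) (α : Fin p → ℕ) (β : Fin q → ℕ)
    (a : Fin p → Fin q → ℕ) : Matrix (Fin n) (Fin n) k :=
  Matrix.of fun r s : Fin n =>
    if ∃ (i : Fin p) (j : Fin q) (t : ℕ), t < a i j ∧
        (s : ℕ) = off α i + offA a i j + t ∧ (r : ℕ) = off β j + offB a i j + t
      then (1 : k) else 0

/-- The standard bi-hinge determined by the dimension data `a`. -/
def stdHinge {p q : ℕ} (α : Fin p → ℕ) (β : Fin q → ℕ) (a : Fin p → Fin q → ℕ)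
    (i : Fin p) (j : Fin q) : Submodule k ((Fin (α i) → k) × (Fin (β j) → k)) where
  carrier := {z | (∀ u : Fin (α i), (u : ℕ) < offA a i j → z.1 u = 0) ∧
    (∀ v : Fin (β j), offB a i j + a i j ≤ (v : ℕ) → z.2 v = 0) ∧
    ∀ (u : Fin (α i)) (v : Fin (β j)) (t : ℕ), t < a i j →
      (u : ℕ) = offA a i j + t → (v : ℕ) = offB a i j + t → z.1 u = z.2 v}
  add_mem' := by
    rintro x y ⟨hx1, hx2, hx3⟩ ⟨hy1, hy2, hy3⟩
    refine ⟨fun u hu => ?_, fun v hv => ?_, fun u v t ht hu hv => ?_⟩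
    · show x.1 u + y.1 u = 0
      rw [hx1 u hu, hy1 u hu, add_zero]
    · show x.2 v + y.2 v = 0
      rw [hx2 v hv, hy2 v hv, add_zero]
    · show x.1 u + y.1 u = x.2 v + y.2 v
      rw [hx3 u v t ht hu hv, hy3 u v t ht hu hv]
  zero_mem' := ⟨fun _ _ => rfl, fun _ _ => rfl, fun _ _ _ _ _ _ => rfl⟩
  smul_mem' := by
    rintro c x ⟨hx1, hx2, hx3⟩
    refine ⟨fun u hu => ?_, fun v hv => ?_, fun u v t ht hu hv => ?_⟩
    · show c * x.1 u = 0
      rw [hx1 u hu, mul_zero]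
    · show c * x.2 v = 0
      rw [hx2 v hv, mul_zero]
    · show c * x.1 u = c * x.2 v
      rw [hx3 u v t ht hu hv]

/-- The diagonal blocks of `g i` and `h j` corresponding to `V_i^j ≅ W_j^i` coincide. -/
def DiagBlocksMatch {p q : ℕ} {α : Fin p → ℕ} {β : Fin q → ℕ} (a : Fin p → Fin q → ℕ)
    (g : ∀ i, Matrix (Fin (α i)) (Fin (α i)) k) (h : ∀ j, Matrix (Fin (β j)) (Fin (β j)) k) :
    Prop :=
  ∀ (i : Fin p) (j : Fin q) (u u' : Fin (α i)) (v v' : Fin (β j)) (t t' : ℕ),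
    t < a i j → t' < a i j →
    (u : ℕ) = offA a i j + t → (u' : ℕ) = offA a i j + t' →
    (v : ℕ) = offB a i j + t → (v' : ℕ) = offB a i j + t' →
    g i u u' = h j v v'

/-- The pair `(g, h)` stabilizes the standard bi-hinge determined by `a`. -/
def StabilizesStd {p q : ℕ} (α : Fin p → ℕ) (β : Fin q → ℕ) (a : Fin p → Fin q → ℕ)
    (g : ∀ i, GL (Fin (α i)) k) (h : ∀ j, GL (Fin (β j)) k) : Prop :=
  ∀ (i : Fin p) (j : Fin q),
    Submodule.map
      (LinearMap.prodMap (Matrix.mulVecLin (g i).val) (Matrix.mulVecLin (h j).val))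
      (stdHinge α β a i j) = stdHinge α β a i j

section Partition

variable {p n : ℕ} {c : Fin p → ℕ}

theorem off_add_le_off {i j : Fin p} (hij : i < j) : off c i + c i ≤ off c j := by
  have h1 : off c i + c i = ∑ l ∈ Finset.Iic i, c l := by
    rw [← Finset.Iio_insert i, Finset.sum_insert (by simp), add_comm, off]
  rw [h1]
  refine Finset.sum_le_sum_of_subset fun l hl => ?_
  rw [Finset.mem_Iic] at hl
  exact Finset.mem_Iio.2 (lt_of_le_of_lt hl hij)

theorem off_mono : Monotone (off c) := fun i j hij => by
  rcases hij.eq_or_lt with rfl | hlt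
  · exact le_rfl
  · exact (Nat.le_add_right _ _).trans (off_add_le_off hlt)

theorem sameBlock_of_off_add {i : Fin p} {t t' : ℕ} (ht : t < c i) (ht' : t' < c i) :
    sameBlock c (off c i + t) (off c i + t') := fun j => by
  rcases le_or_gt j i with hji | hij
  · have := off_mono (c := c) hji
    constructor <;> intro <;> omega
  · have := off_add_le_off (c := c) hij
    constructor <;> intro <;> omega

theorem blockLT_of_lt_of_le (hc : ∑ i, c i = n) (i : Fin p) {s r : ℕ} (hr : r < n)
    (hs : s < off c i + c i) (hir : off c i + c i ≤ r) : blockLT c s r := by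
  by_cases hi : (i : ℕ) + 1 < p
  · have h1 : off c ⟨i + 1, hi⟩ = off c i + c i := by
      have h2 : Finset.Iio (⟨i + 1, hi⟩ : Fin p) = insert i (Finset.Iio i) := by
        ext l
        simp only [Finset.mem_Iio, Finset.mem_insert, Fin.lt_def, Fin.ext_iff]
        omega
      rw [off, h2, Finset.sum_insert (by simp), add_comm, off]
    exact ⟨⟨i + 1, hi⟩, by omega, by omega⟩
  · have h1 : off c i + c i = n := by
      have h2 : (Finset.univ : Finset (Fin p)) = insert i (Finset.Iio i) := by
        ext l
        have := l.isLt
        simp only [Finset.mem_univ, Finset.mem_Iio, Finset.mem_insert, Fin.lt_def, Fin.ext_iff,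
          true_iff]
        omega
      rw [← hc, h2, Finset.sum_insert (by simp), add_comm, off]
    omega

/-- Number of blocks of the partition `c` that start at or before the coordinate `r`. -/
def level (c : Fin p → ℕ) (r : ℕ) : ℕ := (Finset.univ.filter fun i => off c i ≤ r).card

theorem blockLT_iff_level_lt {s r : ℕ} : blockLT c s r ↔ level c s < level c r := by
  constructor
  · rintro ⟨i, hir, hsi⟩
    refine Finset.card_lt_card (Finset.ssubset_iff_of_subset
      (Finset.monotone_filter_right _ fun _ _ h => ?_) |>.2
        ⟨i, by simpa using hir, by simpa using hsi⟩)
    exact h.trans (hsi.le.trans hir)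
  · intro h
    obtain ⟨i, hi, hi'⟩ := Finset.exists_mem_notMem_of_card_lt_card h
    exact ⟨i, by simpa using hi, by simpa using hi'⟩

theorem sameBlock_iff_level_eq {r s : ℕ} : sameBlock c r s ↔ level c r = level c s := by
  constructor
  · intro h
    unfold level
    congr 1
    ext i
    simpa using h i
  · intro h i
    by_contra hi
    rcases not_iff.1 hi with hi
    by_cases hr : off c i ≤ r
    · have : blockLT c s r := ⟨i, hr, by by_contra hs; exact hi.2 (not_lt.1 hs) hr⟩
      have := blockLT_iff_level_lt.1 this
      omega
    · have : blockLT c r s := ⟨i, hi.1 hr, not_le.1 hr⟩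
      have := blockLT_iff_level_lt.1 this
      omega

theorem coord_injective (hc : ∑ i, c i = n) (i : Fin p) : Function.Injective (coord hc i) :=
  fun t t' h => by
    have := congrArg Fin.val h
    simp only [coord] at this
    exact Fin.ext (by omega)

/-- A sum supported on the `i`-th block is a sum over that block. -/
theorem sum_eq_sum_coord (hc : ∑ i, c i = n) (i : Fin p) (f : Fin n → k)
    (h1 : ∀ s : Fin n, (s : ℕ) < off c i → f s = 0)
    (h2 : ∀ s : Fin n, off c i + c i ≤ (s : ℕ) → f s = 0) :
    ∑ s, f s = ∑ t, f (coord hc i t) := by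
  refine (Fintype.sum_of_injective _ (coord_injective hc i) _ _ (fun s hs => ?_)
    fun _ => rfl).symm
  by_cases hs1 : (s : ℕ) < off c i
  · exact h1 s hs1
  by_cases hs2 : off c i + c i ≤ (s : ℕ)
  · exact h2 s hs2
  · exact absurd ⟨⟨s - off c i, by omega⟩, Fin.ext (by simp only [coord]; omega)⟩ hs

end Partition

section BlockDiagonalPart

variable {ι κ : Type*} [LinearOrder κ]

/-- The block diagonal part of a matrix, for the blocks given by the fibres of `b`. -/
def blockDiagPart (b : ι → κ) (M : Matrix ι ι k) : Matrix ι ι k :=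
  Matrix.of fun r s => if b r = b s then M r s else 0

theorem blockDiagPart_apply_of_eq {b : ι → κ} {M : Matrix ι ι k} {r s : ι} (h : b r = b s) :
    blockDiagPart b M r s = M r s := if_pos h

theorem blockDiagPart_apply_of_ne {b : ι → κ} {M : Matrix ι ι k} {r s : ι} (h : b r ≠ b s) :
    blockDiagPart b M r s = 0 := if_neg h

theorem blockDiagPart_eq_self {b : ι → κ} {M : Matrix ι ι k}
    (hM : ∀ r s, b r ≠ b s → M r s = 0) : blockDiagPart b M = M := by
  ext r s
  by_cases h : b r = b s
  · exact blockDiagPart_apply_of_eq h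
  · rw [blockDiagPart_apply_of_ne h, hM r s h]

theorem blockTriangular_of_block_diagonal {b : ι → κ} {M : Matrix ι ι k}
    (hM : ∀ r s, b r ≠ b s → M r s = 0) : M.BlockTriangular b :=
  fun r s hrs => hM r s hrs.ne'

theorem blockTriangular_blockDiagPart (b : ι → κ) (M : Matrix ι ι k) :
    (blockDiagPart b M).BlockTriangular b :=
  blockTriangular_of_block_diagonal fun _ _ => blockDiagPart_apply_of_ne

theorem blockDiagPart_eq_one_iff [DecidableEq ι] {b : ι → κ} {M : Matrix ι ι k} :
    blockDiagPart b M = 1 ↔ ∀ r s, b r = b s → M r s = if r = s then 1 else 0 := by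
  constructor
  · intro h r s hrs
    rw [← blockDiagPart_apply_of_eq (M := M) hrs, h, Matrix.one_apply]
  · intro h
    ext r s
    by_cases hrs : b r = b s
    · rw [blockDiagPart_apply_of_eq hrs, h r s hrs, Matrix.one_apply]
    · rw [blockDiagPart_apply_of_ne hrs, Matrix.one_apply_ne fun e => hrs (congrArg b e)]

variable [Fintype ι]

theorem blockDiagPart_mul {b : ι → κ} {M N : Matrix ι ι k} (hM : M.BlockTriangular b)
    (hN : N.BlockTriangular b) :
    blockDiagPart b (M * N) = blockDiagPart b M * blockDiagPart b N := by
  ext r s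
  by_cases hrs : b r = b s
  · rw [blockDiagPart_apply_of_eq hrs, Matrix.mul_apply, Matrix.mul_apply]
    refine Finset.sum_congr rfl fun t _ => ?_
    rcases lt_trichotomy (b t) (b r) with h | h | h
    · rw [hM h, blockDiagPart_apply_of_ne h.ne', zero_mul, zero_mul]
    · rw [blockDiagPart_apply_of_eq h.symm, blockDiagPart_apply_of_eq (h.trans hrs)]
    · rw [hN (hrs ▸ h), blockDiagPart_apply_of_ne h.ne, mul_zero, zero_mul]
  · rw [blockDiagPart_apply_of_ne hrs, Matrix.mul_apply]
    refine (Finset.sum_eq_zero fun t _ => ?_).symm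
    by_cases hrt : b r = b t
    · rw [blockDiagPart_apply_of_ne (r := t) fun e => hrs (hrt.trans e), mul_zero]
    · rw [blockDiagPart_apply_of_ne hrt, zero_mul]

variable [DecidableEq ι]

theorem blockTriangular_inv {b : ι → κ} {g : GL ι k} (hg : g.val.BlockTriangular b) :
    (g⁻¹).val.BlockTriangular b := by
  have : Invertible g.val := g.invertible
  rw [Matrix.coe_units_inv]
  exact Matrix.blockTriangular_inv_of_blockTriangular hg

theorem blockDiagPart_mul_blockDiagPart_inv {b : ι → κ} {g : GL ι k}
    (hg : g.val.BlockTriangular b) :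
    blockDiagPart b g.val * blockDiagPart b (g⁻¹).val = 1 := by
  rw [← blockDiagPart_mul hg (blockTriangular_inv hg), ← Units.val_mul, mul_inv_cancel,
    Units.val_one, blockDiagPart_eq_one_iff]
  exact fun r s _ => Matrix.one_apply

/-- The block unipotent factor of an invertible block triangular matrix. -/
def unipotentPart (b : ι → κ) (g : GL ι k) : Matrix ι ι k :=
  g.val * blockDiagPart b (g⁻¹).val

theorem blockTriangular_unipotentPart {b : ι → κ} {g : GL ι k} (hg : g.val.BlockTriangular b) :
    (unipotentPart b g).BlockTriangular b :=
  hg.mul (blockTriangular_blockDiagPart _ _)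

theorem blockDiagPart_unipotentPart {b : ι → κ} {g : GL ι k} (hg : g.val.BlockTriangular b) :
    blockDiagPart b (unipotentPart b g) = 1 := by
  rw [unipotentPart, blockDiagPart_mul hg (blockTriangular_blockDiagPart _ _),
    blockDiagPart_eq_self (M := blockDiagPart b _) fun _ _ => blockDiagPart_apply_of_ne,
    blockDiagPart_mul_blockDiagPart_inv hg]

theorem unipotentPart_mul_blockDiagPart {b : ι → κ} {g : GL ι k}
    (hg : g.val.BlockTriangular b) : g.val = unipotentPart b g * blockDiagPart b g.val := by
  rw [unipotentPart, mul_assoc, mul_eq_one_comm.1 (blockDiagPart_mul_blockDiagPart_inv hg),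
    mul_one]

theorem factorization_unique {b : ι → κ} {g : GL ι k} {u d : Matrix ι ι k}
    (hd : ∀ r s, b r ≠ b s → d r s = 0) (hu : u.BlockTriangular b)
    (hu1 : blockDiagPart b u = 1) (h : g.val = u * d) :
    d = blockDiagPart b g.val ∧ u = unipotentPart b g := by
  have hdt := blockTriangular_of_block_diagonal hd
  have hg : g.val.BlockTriangular b := h ▸ hu.mul hdt
  have hdg : d = blockDiagPart b g.val := by
    rw [h, blockDiagPart_mul hu hdt, hu1, one_mul, blockDiagPart_eq_self hd]
  refine ⟨hdg, ?_⟩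
  rw [unipotentPart]
  nth_rewrite 1 [h]
  rw [hdg, mul_assoc, blockDiagPart_mul_blockDiagPart_inv hg, mul_one]

end BlockDiagonalPart

section Levels

variable {p n : ℕ} {c : Fin p → ℕ} {M : Matrix (Fin n) (Fin n) k}

theorem isPPlus_iff : IsPPlus c M ↔ M.BlockTriangular fun r => level c r :=
  forall₂_congr fun _ _ => by rw [blockLT_iff_level_lt]

theorem isPMinus_iff :
    IsPMinus c M ↔ M.BlockTriangular fun r => OrderDual.toDual (level c r) :=
  forall₂_congr fun _ _ => by rw [blockLT_iff_level_lt, OrderDual.toDual_lt_toDual]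

theorem isTPlus_iff :
    IsTPlus c M ↔ M.BlockTriangular (fun r => level c r) ∧
      blockDiagPart (fun r : Fin n => level c r) M = 1 := by
  simp only [IsTPlus, isPPlus_iff, blockDiagPart_eq_one_iff, sameBlock_iff_level_eq]

theorem isTMinus_iff :
    IsTMinus c M ↔ M.BlockTriangular (fun r => OrderDual.toDual (level c r)) ∧
      blockDiagPart (fun r : Fin n => OrderDual.toDual (level c r)) M = 1 := by
  simp only [IsTMinus, isPMinus_iff, blockDiagPart_eq_one_iff, sameBlock_iff_level_eq,
    OrderDual.toDual_inj]

end Levels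

section Stabilizer

variable {p q : ℕ} {α : Fin p → ℕ} {β : Fin q → ℕ} {a : Fin p → Fin q → ℕ}
  {g : ∀ i, GL (Fin (α i)) k} {h : ∀ j, GL (Fin (β j)) k}

theorem StabilizesStd.mulVec_mem (H : StabilizesStd α β a g h) {i : Fin p} {j : Fin q}
    {x : Fin (α i) → k} {y : Fin (β j) → k} (hxy : (x, y) ∈ stdHinge α β a i j) :
    ((g i).val.mulVec x, (h j).val.mulVec y) ∈ stdHinge α β a i j := by
  rw [← H i j]
  exact ⟨(x, y), hxy, rfl⟩

theorem StabilizesStd.isPMinus (H : StabilizesStd α β a g h) (i : Fin p) :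
    IsPMinus (a i) (g i).val := by
  rintro r s ⟨j, hjs, hrj⟩
  change offA a i j ≤ s at hjs
  change (r : ℕ) < offA a i j at hrj
  have hmem : ((Pi.single s 1, fun v => if (s : ℕ) + offB a i j = v + offA a i j ∧
      (v : ℕ) < offB a i j + a i j then 1 else 0) : (Fin (α i) → k) × (Fin (β j) → k)) ∈
        stdHinge α β a i j := by
    refine ⟨fun u hu => ?_, fun v hv => ?_, fun u v t ht hu hv => ?_⟩
    · exact Pi.single_eq_of_ne (fun e => by subst e; omega) _
    · exact if_neg (by omega)
    · simp only [Pi.single_apply, Fin.ext_iff]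
      refine if_congr ?_ rfl rfl
      omega
  have := (H.mulVec_mem hmem).1 r hrj
  rwa [Matrix.mulVec_single_one] at this

theorem StabilizesStd.isPPlus (hrow : ∀ i, ∑ j, a i j = α i) (H : StabilizesStd α β a g h)
    (j : Fin q) : IsPPlus (fun i => a i j) (h j).val := by
  rintro r s ⟨i, hir, hsi⟩
  change offB a i j ≤ r at hir
  change (s : ℕ) < offB a i j at hsi
  have hmem : ((0, Pi.single s 1) : (Fin (α i) → k) × (Fin (β j) → k)) ∈
      stdHinge α β a i j := by
    refine ⟨fun u hu => rfl, fun v hv => ?_, fun u v t ht hu hv => ?_⟩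
    · exact Pi.single_eq_of_ne (fun e => by subst e; omega) _
    · symm
      exact Pi.single_eq_of_ne (fun e => by subst e; omega) _
  obtain ⟨-, h2, h3⟩ := H.mulVec_mem hmem
  simp only [Matrix.mulVec_single_one, Matrix.mulVec_zero] at h2 h3
  by_cases hr : offB a i j + a i j ≤ r
  · exact h2 r hr
  · have ht : (r : ℕ) - offB a i j < a i j := by omega
    exact (h3 (coord (hrow i) j ⟨_, ht⟩) r _ ht rfl (by omega)).symm

theorem StabilizesStd.diagBlocksMatch (H : StabilizesStd α β a g h) :
    DiagBlocksMatch a (fun i => (g i).val) (fun j => (h j).val) := by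
  intro i j u u' v v' t t' ht ht' hu hu' hv hv'
  have hmem : ((Pi.single u' 1, Pi.single v' 1) : (Fin (α i) → k) × (Fin (β j) → k)) ∈
      stdHinge α β a i j := by
    refine ⟨fun w hw => ?_, fun w hw => ?_, fun w w' l hl hw hw' => ?_⟩
    · exact Pi.single_eq_of_ne (fun e => by subst e; omega) _
    · exact Pi.single_eq_of_ne (fun e => by subst e; omega) _
    · simp only [Pi.single_apply, Fin.ext_iff]
      refine if_congr ?_ rfl rfl
      omega
  have := (H.mulVec_mem hmem).2.2 u v t ht hu hv
  simpa only [Matrix.mulVec_single_one, Matrix.col_apply] using this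

theorem mulVec_mem_stdHinge (hrow : ∀ i, ∑ j, a i j = α i) (hcol : ∀ j, ∑ i, a i j = β j)
    (hg : ∀ i, IsPMinus (a i) (g i).val) (hh : ∀ j, IsPPlus (fun i => a i j) (h j).val)
    (hgh : DiagBlocksMatch a (fun i => (g i).val) (fun j => (h j).val)) {i : Fin p} {j : Fin q}
    {x : Fin (α i) → k} {y : Fin (β j) → k} (hxy : (x, y) ∈ stdHinge α β a i j) :
    ((g i).val.mulVec x, (h j).val.mulVec y) ∈ stdHinge α β a i j := by
  obtain ⟨hx, hy, hm⟩ := hxy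
  refine ⟨fun u hu => ?_, fun v hv => ?_, fun u v t ht hu hv => ?_⟩
  · change ∑ s, (g i).val u s * x s = 0
    refine Finset.sum_eq_zero fun s _ => ?_
    by_cases hs : (s : ℕ) < offA a i j
    · exact mul_eq_zero_of_right _ (hx s hs)
    · exact mul_eq_zero_of_left (hg i u s ⟨j, not_lt.1 hs, hu⟩) _
  · change ∑ s, (h j).val v s * y s = 0
    refine Finset.sum_eq_zero fun s _ => ?_
    by_cases hs : offB a i j + a i j ≤ s
    · exact mul_eq_zero_of_right _ (hy s hs)
    · exact mul_eq_zero_of_left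
        (hh j v s (blockLT_of_lt_of_le (hcol j) i v.isLt (not_le.1 hs) hv)) _
  · change ∑ s, (g i).val u s * x s = ∑ s, (h j).val v s * y s
    rw [sum_eq_sum_coord (hrow i) j _
        (fun s hs => mul_eq_zero_of_right _ (hx s hs))
        (fun s hs => mul_eq_zero_of_left (hg i u s (blockLT_of_lt_of_le (hrow i) j s.isLt
          (by rw [hu]; exact Nat.add_lt_add_left ht _) hs)) _),
      sum_eq_sum_coord (hcol j) i _
        (fun s hs => mul_eq_zero_of_left
          (hh j v s ⟨i, by rw [hv]; exact Nat.le_add_right _ _, hs⟩) _)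
        (fun s hs => mul_eq_zero_of_right _ (hy s hs))]
    refine Finset.sum_congr rfl fun l _ => ?_
    exact congrArg₂ (· * ·) (hgh i j _ _ _ _ t l ht l.isLt hu rfl hv rfl)
      (hm _ _ l l.isLt rfl rfl)

theorem stabilizesStd_of_blocks (hrow : ∀ i, ∑ j, a i j = α i) (hcol : ∀ j, ∑ i, a i j = β j)
    (hg : ∀ i, IsPMinus (a i) (g i).val) (hh : ∀ j, IsPPlus (fun i => a i j) (h j).val)
    (hgh : DiagBlocksMatch a (fun i => (g i).val) (fun j => (h j).val)) :
    StabilizesStd α β a g h := by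
  intro i j
  refine Submodule.eq_of_le_of_finrank_eq ?_ ?_
  · rintro _ ⟨⟨x, y⟩, hxy, rfl⟩
    exact mulVec_mem_stdHinge hrow hcol hg hh hgh hxy
  · refine (Submodule.equivMapOfInjective _ ?_ _).finrank_eq.symm
    exact (Matrix.mulVec_injective_of_isUnit (g i).isUnit).prodMap
      (Matrix.mulVec_injective_of_isUnit (h j).isUnit)

theorem diagBlocksMatch_blockDiagPart
    (hgh : DiagBlocksMatch a (fun i => (g i).val) (fun j => (h j).val)) :
    DiagBlocksMatch a
      (fun i => blockDiagPart (fun r : Fin (α i) => OrderDual.toDual (level (a i) r)) (g i).val)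
      (fun j => blockDiagPart (fun r : Fin (β j) => level (fun i => a i j) r) (h j).val) := by
  intro i j u u' v v' t t' ht ht' hu hu' hv hv'
  dsimp only
  rw [blockDiagPart_apply_of_eq, blockDiagPart_apply_of_eq]
  · exact hgh i j u u' v v' t t' ht ht' hu hu' hv hv'
  · rw [hv, hv']
    exact sameBlock_iff_level_eq.1 (sameBlock_of_off_add (c := fun i => a i j) ht ht')
  · rw [hu, hu']
    exact congrArg _ (sameBlock_iff_level_eq.1 (sameBlock_of_off_add (c := a i) ht ht'))

end Stabilizer

theorem statement14 (p q n : ℕ) (hp : 0 < p) (hq : 0 < q)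
    (α : Fin p → ℕ) (β : Fin q → ℕ)
    (hαpos : ∀ i, 0 < α i) (hβpos : ∀ j, 0 < β j)
    (hα : ∑ i, α i = n) (hβ : ∑ j, β j = n)
    (a : Fin p → Fin q → ℕ)
    (hrow : ∀ i, ∑ j, a i j = α i) (hcol : ∀ j, ∑ i, a i j = β j)
    (g : ∀ i, GL (Fin (α i)) k) (h : ∀ j, GL (Fin (β j)) k) :
    (StabilizesStd α β a g h ↔
      ((∀ i, IsPMinus (a i) (g i).val) ∧
       (∀ j, IsPPlus (fun i' => a i' j) (h j).val) ∧
       DiagBlocksMatch a (fun i => (g i).val) (fun j => (h j).val))) ∧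
    (StabilizesStd α β a g h →
      ∃ (dg : ∀ i, Matrix (Fin (α i)) (Fin (α i)) k)
        (dh : ∀ j, Matrix (Fin (β j)) (Fin (β j)) k)
        (ug : ∀ i, Matrix (Fin (α i)) (Fin (α i)) k)
        (uh : ∀ j, Matrix (Fin (β j)) (Fin (β j)) k),
        (∀ i, ∀ r s : Fin (α i), ¬ sameBlock (a i) (r : ℕ) (s : ℕ) → dg i r s = 0) ∧
        (∀ j, ∀ r s : Fin (β j), ¬ sameBlock (fun i' => a i' j) (r : ℕ) (s : ℕ) → dh j r s = 0) ∧
        DiagBlocksMatch a dg dh ∧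
        (∀ i, IsTMinus (a i) (ug i)) ∧
        (∀ j, IsTPlus (fun i' => a i' j) (uh j)) ∧
        (∀ i, (g i).val = ug i * dg i) ∧ (∀ j, (h j).val = uh j * dh j) ∧
        (∀ (dg' : ∀ i, Matrix (Fin (α i)) (Fin (α i)) k)
           (dh' : ∀ j, Matrix (Fin (β j)) (Fin (β j)) k)
           (ug' : ∀ i, Matrix (Fin (α i)) (Fin (α i)) k)
           (uh' : ∀ j, Matrix (Fin (β j)) (Fin (β j)) k),
          (∀ i, ∀ r s : Fin (α i), ¬ sameBlock (a i) (r : ℕ) (s : ℕ) → dg' i r s = 0) →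
          (∀ j, ∀ r s : Fin (β j), ¬ sameBlock (fun i' => a i' j) (r : ℕ) (s : ℕ) → dh' j r s = 0) →
          DiagBlocksMatch a dg' dh' →
          (∀ i, IsTMinus (a i) (ug' i)) →
          (∀ j, IsTPlus (fun i' => a i' j) (uh' j)) →
          (∀ i, (g i).val = ug' i * dg' i) → (∀ j, (h j).val = uh' j * dh' j) →
          dg' = dg ∧ dh' = dh ∧ ug' = ug ∧ uh' = uh)) := by
  refine ⟨⟨fun H => ⟨H.isPMinus, H.isPPlus hrow, H.diagBlocksMatch⟩,
    fun ⟨hg, hh, hgh⟩ => stabilizesStd_of_blocks hrow hcol hg hh hgh⟩, fun H => ?_⟩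
  have hg := fun i => isPMinus_iff.1 (H.isPMinus i)
  have hh := fun j => isPPlus_iff.1 (H.isPPlus hrow j)
  refine ⟨_, _, fun i => unipotentPart (fun r => OrderDual.toDual (level (a i) r)) (g i),
    fun j => unipotentPart (fun r => level (fun i => a i j) r) (h j), ?_, ?_,
    diagBlocksMatch_blockDiagPart H.diagBlocksMatch, ?_, ?_, ?_, ?_, ?_⟩
  · exact fun i r s hrs => blockDiagPart_apply_of_ne fun e => hrs (sameBlock_iff_level_eq.2 e)
  · exact fun j r s hrs => blockDiagPart_apply_of_ne fun e => hrs (sameBlock_iff_level_eq.2 e)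
  · exact fun i => isTMinus_iff.2
      ⟨blockTriangular_unipotentPart (hg i), blockDiagPart_unipotentPart (hg i)⟩
  · exact fun j => isTPlus_iff.2
      ⟨blockTriangular_unipotentPart (hh j), blockDiagPart_unipotentPart (hh j)⟩
  · exact fun i => unipotentPart_mul_blockDiagPart (hg i)
  · exact fun j => unipotentPart_mul_blockDiagPart (hh j)
  · intro dg' dh' ug' uh' hdg hdh _ hug huh hgeq hheq
    have hG := fun i => factorization_unique
      (fun r s hrs => hdg i r s fun e =>
        hrs (congrArg OrderDual.toDual (sameBlock_iff_level_eq.1 e)))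
      (isTMinus_iff.1 (hug i)).1 (isTMinus_iff.1 (hug i)).2 (hgeq i)
    have hH := fun j => factorization_unique
      (fun r s hrs => hdh j r s fun e => hrs (sameBlock_iff_level_eq.1 e))
      (isTPlus_iff.1 (huh j)).1 (isTPlus_iff.1 (huh j)).2 (hheq j)
    exact ⟨funext fun i => (hG i).1, funext fun j => (hH j).1,
      funext fun i => (hG i).2, funext fun j => (hH j).2⟩

end Neretin
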